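/- Let n, r be positive integers with 2r ≤ n and let m ≥ 4nr − 4r². Let A₁, …, A_m : Ω → Matrix (Fin n) (Fin n) ℝ be a Gaussian measurement ensemble, i.e., the m·n² real entries of A₁(ω), …, A_m(ω) are i.i.d. standard Gaussian random variables. Then ℙ-almost surely: for every nonzero matrix Z with rank Z ≤ 2r there exists an index i ∈ {1, …, m} with trace(Aᵢ(ω)ᵀ Z) ≠ 0. (That is, with probability one the null space of the measurement operator contains no nonzero matrix of rank at most 2r.) -/

import Mathlib

open MeasureTheory ProbabilityTheory Matrix

theorem MeasureTheory.Measure.pi_le_pi {ι : Type*} [Fintype ι] {α : ι → Type*}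
    [∀ i, MeasurableSpace (α i)] {μ ν : ∀ i, Measure (α i)} [∀ i, SigmaFinite (μ i)]
    (h : ∀ i, μ i ≤ ν i) : Measure.pi μ ≤ Measure.pi ν := by
  refine Measure.le_iff.2 fun s hs => ?_
  rw [Measure.pi_def ν, toMeasure_apply _ _ hs]
  refine (OuterMeasure.le_pi (n := (Measure.pi μ).toOuterMeasure)).2 (fun t _ => ?_) s
  change Measure.pi μ (Set.univ.pi t) ≤ _
  rw [Measure.pi_pi]
  exact Finset.prod_le_prod' fun i _ => h i _

theorem gaussianReal_zero_one_le_volume : gaussianReal 0 1 ≤ volume := by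
  rw [gaussianReal_of_var_ne_zero 0 one_ne_zero]
  conv_rhs => rw [← withDensity_one (μ := (volume : Measure ℝ))]
  refine withDensity_mono (.of_forall fun x => ?_)
  rw [gaussianPDF, Pi.one_apply, ENNReal.ofReal_le_one, gaussianPDFReal]
  refine mul_le_one₀ (inv_le_one_of_one_le₀ (Real.one_le_sqrt.2 ?_)) (Real.exp_nonneg _)
    (Real.exp_le_one_iff.2 ?_)
  · simp only [NNReal.coe_one]
    linarith [Real.pi_gt_three]
  · simp only [NNReal.coe_one, neg_div]
    exact neg_nonpos.2 (by positivity)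

/-- A `C¹` image of a Euclidean space of smaller dimension is Lebesgue null. -/
theorem ContDiff.volume_range_eq_zero {E ι : Type*} [NormedAddCommGroup E] [NormedSpace ℝ E]
    [FiniteDimensional ℝ E] [Fintype ι] {f : E → ι → ℝ} (hf : ContDiff ℝ 1 f)
    (h : Module.finrank ℝ E < Fintype.card ι) : volume (Set.range f) = 0 := by
  rw [← hausdorffMeasure_pi_real]
  refine hausdorffMeasure_of_dimH_lt (d := (Fintype.card ι : NNReal)) (hf.dimH_range_le.trans_lt ?_)
  exact_mod_cast h

/-- A `C¹` family, with fewer than `|κ|` parameters, of vectors normalized at the coordinate `p₀`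
almost surely has no member orthogonal to all of `|κ|` generic vectors. -/
theorem volume_exists_orthogonal_eq_zero {E κ ι : Type*} [NormedAddCommGroup E]
    [NormedSpace ℝ E] [FiniteDimensional ℝ E] [Fintype κ] [Fintype ι] (z : E → ι → ℝ)
    (hz : ContDiff ℝ 1 z) (h : Module.finrank ℝ E < Fintype.card κ) (p₀ : ι) :
    volume {x : κ × ι → ℝ | ∃ e, z e p₀ = 1 ∧ ∀ i, ∑ p, x (i, p) * z e p = 0} = 0 := by
  classical
  let f : E × (κ × {p // p ≠ p₀} → ℝ) → κ × ι → ℝ := fun y ip =>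
    if hp : ip.2 = p₀ then -∑ p : {p // p ≠ p₀}, y.2 (ip.1, p) * z y.1 p
    else y.2 (ip.1, ⟨ip.2, hp⟩)
  have hf : ContDiff ℝ 1 f := by
    refine contDiff_pi.2 fun ip => ?_
    by_cases hp : ip.2 = p₀
    · simp only [f, hp, dif_pos]
      have hz' := contDiff_pi.1 hz
      fun_prop
    · simp only [f, hp, dif_neg, not_false_iff]
      fun_prop
  refine measure_mono_null ?_ (hf.volume_range_eq_zero ?_)
  · rintro x ⟨e, he, hx⟩
    refine ⟨(e, fun ip => x (ip.1, ip.2)), funext fun ⟨i, p⟩ => ?_⟩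
    by_cases hp : p = p₀
    · subst hp
      have := hx i
      rw [Fintype.sum_eq_add_sum_subtype_ne _ p, he, mul_one] at this
      simpa [f] using (eq_neg_of_add_eq_zero_left this).symm
    · simp [f, hp]
  · have : Fintype.card {p // p ≠ p₀} + 1 = Fintype.card ι := by
      rw [Fintype.card_subtype_compl, Fintype.card_subtype_eq]
      exact Nat.sub_add_cancel (Fintype.card_pos_iff.2 ⟨p₀⟩)
    rw [Module.finrank_prod, Module.finrank_fintype_fun_eq_card, Fintype.card_prod,
      Fintype.card_prod, ← this, mul_add]
    omega

/-- If `A` has rank at most `k`, some `k` of its rows span all of them. -/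
theorem Matrix.exists_finset_rows_span {l n K : Type*} [Fintype l] [Fintype n] [Field K]
    (A : Matrix l n K) {k : ℕ} (hA : A.rank ≤ k) (hk : k ≤ Fintype.card l) :
    ∃ S : Finset l, S.card = k ∧ ∃ c : l → S → K, ∀ i, A i = ∑ t, c i t • A t := by
  classical
  obtain ⟨κ, a, ha, hspan, hli⟩ := exists_linearIndependent' K A.row
  have : Finite κ := Finite.of_injective a ha
  have : Fintype κ := Fintype.ofFinite κ
  have hcard : (Finset.univ.image a).card ≤ k := by
    rw [Finset.card_image_of_injective _ ha, Finset.card_univ]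
    rwa [A.rank_eq_finrank_span_row, ← hspan, finrank_span_eq_card hli] at hA
  obtain ⟨S, hS, hSk⟩ := Finset.exists_superset_card_eq hcard hk
  refine ⟨S, hSk, ?_⟩
  have hmem (i : l) : A i ∈ Submodule.span K (Set.range fun t : S => A t) := by
    have hi : A i ∈ Submodule.span K (Set.range (A.row ∘ a)) :=
      hspan ▸ Submodule.subset_span ⟨i, rfl⟩
    refine Submodule.span_mono ?_ hi
    rintro _ ⟨q, rfl⟩
    exact ⟨⟨a q, hS (Finset.mem_image_of_mem a (Finset.mem_univ q))⟩, rfl⟩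
  choose c hc using fun i => (Submodule.mem_span_range_iff_exists_fun K).1 (hmem i)
  exact ⟨c, fun i => (hc i).symm⟩

section RankChart

variable {l n : Type*} [DecidableEq l] [DecidableEq n]

/-- The matrix whose rows in `S` are `e.2`, completed by `1` at the position `p₀`, and whose other
rows are the linear combinations of these with coefficients `e.1`. -/
noncomputable def rankChart (S : Finset l) (p₀ : S × n)
    (e : ({i // i ∉ S} × S → ℝ) × ({p // p ≠ p₀} → ℝ)) (p : l × n) : ℝ :=
  let w : S × n → ℝ := fun q => if hq : q = p₀ then 1 else e.2 ⟨q, hq⟩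
  if hp : p.1 ∈ S then w (⟨p.1, hp⟩, p.2) else ∑ t, e.1 (⟨p.1, hp⟩, t) * w (t, p.2)


theorem contDiff_rankChart [Fintype l] [Fintype n] (S : Finset l) (p₀ : S × n) : ContDiff ℝ 1 (rankChart S p₀) := by
  have hw (q : S × n) : ContDiff ℝ 1
      fun e : ({i // i ∉ S} × S → ℝ) × ({p // p ≠ p₀} → ℝ) =>
        if hq : q = p₀ then 1 else e.2 ⟨q, hq⟩ := by
    by_cases hq : q = p₀
    · simp only [hq, dif_pos]
      fun_prop
    · simp only [hq, dif_neg, not_false_iff]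
      fun_prop
  refine contDiff_pi.2 fun p => ?_
  by_cases hp : p.1 ∈ S
  · simpa only [rankChart, hp, dif_pos] using hw _
  · simp only [rankChart, hp, dif_neg, not_false_iff]
    exact ContDiff.sum fun t _ => ContDiff.mul (by fun_prop) (hw _)

theorem rankChart_eq (S : Finset l) (p₀ : S × n) (Z : Matrix l n ℝ) (hZ : Z p₀.1 p₀.2 = 1)
    (c : l → S → ℝ) (hc : ∀ i, Z i = ∑ t, c i t • Z t) (p : l × n) :
    rankChart S p₀ (fun q => c q.1 q.2, fun q => Z q.1.1 q.1.2) p = Z p.1 p.2 := by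
  have hw (q : S × n) : (if q = p₀ then 1 else Z q.1 q.2) = Z q.1 q.2 := by
    split_ifs with hq
    · rw [hq, hZ]
    · rfl
  by_cases hp : p.1 ∈ S
  · simp [rankChart, hp, hw (⟨p.1, hp⟩, p.2)]
  · simpa [rankChart, hp, hw] using (congrFun (hc p.1) p.2).symm

theorem finrank_rankChart_domain [Fintype l] [Fintype n] (S : Finset l) (p₀ : S × n) :
    Module.finrank ℝ (({i // i ∉ S} × S → ℝ) × ({p // p ≠ p₀} → ℝ)) + 1 =
      (Fintype.card l - S.card) * S.card + S.card * Fintype.card n := by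
  have : Fintype.card {p // p ≠ p₀} + 1 = S.card * Fintype.card n := by
    rw [Fintype.card_subtype_compl, Fintype.card_subtype_eq,
      Nat.sub_add_cancel (Fintype.card_pos_iff.2 ⟨p₀⟩), Fintype.card_prod, Fintype.card_coe]
  rw [Module.finrank_prod, Module.finrank_fintype_fun_eq_card,
    Module.finrank_fintype_fun_eq_card, add_assoc, this, Fintype.card_prod, Fintype.card_coe,
    Fintype.card_subtype_compl, Fintype.card_coe]

end RankChart

/-- Outside a Lebesgue null set, the matrices `A i`, for `i : κ`, are not all orthogonal to a
nonzero matrix of rank at most `k`, if `|κ|` is at least the dimension of the variety of matrices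
of rank at most `k`. -/
theorem ae_volume_no_low_rank_orthogonal {κ l n : Type*} [Fintype κ] [Fintype l] [Fintype n] {k : ℕ}
    (hk : k ≤ Fintype.card l)
    (hκ : (Fintype.card l - k) * k + k * Fintype.card n ≤ Fintype.card κ) :
    ∀ᵐ x : κ × l × n → ℝ, ∀ Z : Matrix l n ℝ, Z ≠ 0 → Z.rank ≤ k →
      ∃ i, ∑ p : l × n, x (i, p) * Z p.1 p.2 ≠ 0 := by
  classical
  have h : ∀ᵐ x : κ × l × n → ℝ, ∀ (S : {S : Finset l // S.card = k}) (p₀ : S.1 × n),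
      ¬∃ e, rankChart S.1 p₀ e (p₀.1, p₀.2) = 1 ∧
        ∀ i, ∑ p, x (i, p) * rankChart S.1 p₀ e p = 0 := by
    refine ae_all_iff.2 fun S => ae_all_iff.2 fun p₀ => measure_eq_zero_iff_ae_notMem.1
      (volume_exists_orthogonal_eq_zero _ (contDiff_rankChart S.1 p₀) ?_ _)
    have := finrank_rankChart_domain S.1 p₀
    rw [S.2] at this
    omega
  filter_upwards [h] with x hx Z hZ hrank
  obtain ⟨S, hS, c, hc⟩ := Z.exists_finset_rows_span hrank hk
  by_contra! hZx
  obtain ⟨p₀, hp₀⟩ : ∃ p₀ : S × n, Z p₀.1 p₀.2 ≠ 0 := by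
    by_contra! h0
    have h0' (t : S) : Z t = 0 := funext fun j => h0 (t, j)
    exact hZ (funext fun i => (hc i).trans (Finset.sum_eq_zero fun t _ => by rw [h0', smul_zero]))
  set b := (Z p₀.1 p₀.2)⁻¹
  have hchart := rankChart_eq S p₀ (b • Z) (by simp [b, hp₀]) c fun i => by
    change b • Z i = ∑ t, c i t • b • Z t
    rw [hc i, Finset.smul_sum]
    exact Finset.sum_congr rfl fun t _ => smul_comm _ _ _
  refine hx ⟨S, hS⟩ p₀ ⟨_, (hchart _).trans (by simp [b, hp₀]), fun i => ?_⟩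
  rw [← mul_zero b, ← hZx i, Finset.mul_sum]
  refine Finset.sum_congr rfl fun p _ => ?_
  rw [hchart, Matrix.smul_apply, smul_eq_mul, mul_left_comm]

/-- If `m ≥ 4nr - 4r²` and the `m·n²` entries of the random measurement matrices
`A 1, …, A m` are i.i.d. standard Gaussians, then almost surely the null space of the
measurement operator `X ↦ (trace (Aᵢᵀ X))ᵢ` contains no nonzero matrix of rank at
most `2r`. -/
theorem no_low_rank_in_nullspace_gaussian
    {Ω : Type*} [MeasurableSpace Ω] (P : Measure Ω) [IsProbabilityMeasure P]
    (n r m : ℕ) (hn : 0 < n) (hr : 0 < r) (h2r : 2 * r ≤ n)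
    (hm : 4 * n * r - 4 * r ^ 2 ≤ m)
    (A : Fin m → Ω → Matrix (Fin n) (Fin n) ℝ)
    (hiid : Measure.map (fun ω => fun p : Fin m × Fin n × Fin n => A p.1 ω p.2.1 p.2.2) P
      = Measure.pi fun _ : Fin m × Fin n × Fin n => gaussianReal 0 1) :
    ∀ᵐ ω ∂P, ∀ Z : Matrix (Fin n) (Fin n) ℝ,
      Z ≠ 0 → Z.rank ≤ 2 * r → ∃ i : Fin m, ((A i ω)ᵀ * Z).trace ≠ 0 := by
  have hA : AEMeasurable (fun ω => fun p : Fin m × Fin n × Fin n => A p.1 ω p.2.1 p.2.2) P := by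
    by_contra hA
    rw [Measure.map_of_not_aemeasurable hA] at hiid
    exact NeZero.ne _ hiid.symm
  have hcard : (n - 2 * r) * (2 * r) + 2 * r * n ≤ m := by
    obtain ⟨d, rfl⟩ := Nat.exists_eq_add_of_le h2r
    refine le_trans (le_of_eq ?_) hm
    rw [Nat.add_sub_cancel_left]
    refine (Nat.sub_eq_of_eq_add ?_).symm
    ring
  have hae := ae_volume_no_low_rank_orthogonal (κ := Fin m) (l := Fin n) (n := Fin n)
    (k := 2 * r) (by simpa using h2r) (by simpa using hcard)
  have hle := Measure.pi_le_pi fun _ : Fin m × Fin n × Fin n => gaussianReal_zero_one_le_volume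
  have hmap := ae_mono hle hae
  rw [← hiid] at hmap
  filter_upwards [ae_of_ae_map hA hmap] with ω hω Z hZ hrank
  obtain ⟨i, hi⟩ := hω Z hZ hrank
  refine ⟨i, ?_⟩
  convert hi using 1
  rw [Fintype.sum_prod_type, Finset.sum_comm]
  simp [Matrix.trace, Matrix.mul_apply]
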